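/- arXiv:2603.13938 — 3 statements merged into one kernel-verified Lean document; each statement's English description precedes it below -/
import Mathlib

section
/- Let ρ ≥ 1, let β, ω : Fin ρ → ℝ satisfy β i > 0 and ω i > 0 for all i, and set d := min over i of ω i (so d > 0). Then there exists a constant c > 0 such that for every B : Fin ρ → ℝ with B i ≥ 1 for all i, the sum, over all n : Fin ρ → ℕ with n i ≥ 1 for all i and such that (n i : ℝ) ≥ (1 / β i) * Real.log (B i) + 1 for at least one index i, of ∏ j, Real.exp (-(n j : ℝ) * β j * ω j), is at most c * (min over i of B i)^(−d). -/
/-- A finite product of nonnegative summable families is summable over the product index type. -/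
theorem summable_prod_pi_of_nonneg {ι κ : Type*} [Fintype ι] {f : ι → κ → ℝ}
    (hf₀ : ∀ i k, 0 ≤ f i k) (hf : ∀ i, Summable (f i)) :
    Summable fun n : ι → κ => ∏ i, f i (n i) := by
  classical
  refine summable_of_sum_le (c := ∏ i, ∑' k, f i k)
    (fun n => Finset.prod_nonneg fun i _ => hf₀ i (n i)) fun s => ?_
  have hs : s ⊆ Fintype.piFinset fun i => s.image fun n => n i := fun n hn =>
    Fintype.mem_piFinset.2 fun i => Finset.mem_image_of_mem (fun n : ι → κ => n i) hn
  calc ∑ n ∈ s, ∏ i, f i (n i)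
      ≤ ∑ n ∈ Fintype.piFinset fun i => s.image fun n => n i, ∏ i, f i (n i) :=
        Finset.sum_le_sum_of_subset_of_nonneg hs
          fun n _ _ => Finset.prod_nonneg fun i _ => hf₀ i (n i)
    _ = ∏ i, ∑ k ∈ s.image fun n => n i, f i k := (Finset.prod_univ_sum _ _).symm
    _ ≤ ∏ i, ∑' k, f i k :=
        Finset.prod_le_prod (fun i _ => Finset.sum_nonneg fun k _ => hf₀ i k)
          fun i _ => (hf i).sum_le_tsum _ fun k _ => hf₀ i k

theorem summable_exp_neg_nat_mul {a b : ℝ} (ha : 0 < a) (hb : 0 < b) :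
    Summable fun k : ℕ => Real.exp (-(k : ℝ) * a * b) := by
  refine (Real.summable_exp_nat_mul_iff.2 (neg_neg_of_pos (mul_pos ha hb))).congr fun k => ?_
  ring_nf

/-- Shifting one coordinate of an exponential product down by `N ≥ log (B i) / β i` gains a factor
at most `(⨅ i, B i) ^ (-(⨅ i, ω i))`. -/
theorem prod_exp_le_of_shift {ι : Type*} [Fintype ι] [DecidableEq ι] {β ω B : ι → ℝ}
    (hβ : ∀ i, 0 < β i) (hω : ∀ i, 0 < ω i) (hB : ∀ i, 1 ≤ B i) (n : ι → ℕ) (i : ι) {N : ℕ}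
    (hN : Real.log (B i) / β i ≤ N) (hn : N ≤ n i) :
    ∏ j, Real.exp (-(n j : ℝ) * β j * ω j) ≤
      (⨅ i, B i) ^ (-(⨅ i, ω i)) *
        ∏ j, Real.exp (-(Function.update n i (n i - N) j : ℝ) * β j * ω j) := by
  have : Nonempty ι := ⟨i⟩
  have hBpos : 0 < B i := zero_lt_one.trans_le (hB i)
  have hinf : 1 ≤ ⨅ i, B i := le_ciInf hB
  have hfactor : Real.exp (-(N : ℝ) * β i * ω i) ≤ (⨅ i, B i) ^ (-(⨅ i, ω i)) :=
    calc Real.exp (-(N : ℝ) * β i * ω i)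
        ≤ B i ^ (-ω i) := by
          rw [Real.rpow_def_of_pos hBpos, Real.exp_le_exp]
          nlinarith [mul_le_mul_of_nonneg_right ((div_le_iff₀ (hβ i)).1 hN) (hω i).le]
      _ ≤ B i ^ (-(⨅ i, ω i)) :=
          Real.rpow_le_rpow_of_exponent_le (hB i)
            (neg_le_neg (ciInf_le (Set.finite_range ω).bddBelow i))
      _ ≤ (⨅ i, B i) ^ (-(⨅ i, ω i)) :=
          Real.rpow_le_rpow_of_nonpos (zero_lt_one.trans_le hinf)
            (ciInf_le (Set.finite_range B).bddBelow i)
            (neg_nonpos.2 (Real.iInf_nonneg fun i => (hω i).le))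
  have hsplit : ∏ j, Real.exp (-(n j : ℝ) * β j * ω j) = Real.exp (-(N : ℝ) * β i * ω i) *
      ∏ j, Real.exp (-(Function.update n i (n i - N) j : ℝ) * β j * ω j) := by
    rw [← Finset.mul_prod_erase _ _ (Finset.mem_univ i),
      ← Finset.mul_prod_erase _ (fun j => Real.exp (-(Function.update n i (n i - N) j : ℝ) * _ * _))
        (Finset.mem_univ i), ← mul_assoc, ← Real.exp_add]
    congr 1
    · rw [Function.update_self, Nat.cast_sub hn]
      ring_nf
    · refine Finset.prod_congr rfl fun j hj => ?_
      rw [Function.update_of_ne (Finset.ne_of_mem_erase hj)]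
  rw [hsplit]
  exact mul_le_mul_of_nonneg_right hfactor (Finset.prod_nonneg fun j _ => (Real.exp_pos _).le)

theorem stmt_3 (ρ : ℕ) (hρ : 1 ≤ ρ) (β ω : Fin ρ → ℝ) (hβ : ∀ i, 0 < β i)
    (hω : ∀ i, 0 < ω i) :
    ∃ c > (0 : ℝ), ∀ B : Fin ρ → ℝ, (∀ i, 1 ≤ B i) →
      (∑' n : {n : Fin ρ → ℕ //
          (∀ i, 1 ≤ n i) ∧ ∃ i, (n i : ℝ) ≥ (1 / β i) * Real.log (B i) + 1},
        ∏ j, Real.exp (-(n.1 j : ℝ) * β j * ω j))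
      ≤ c * (⨅ i, B i) ^ (-(⨅ i, ω i)) := by
  set P : (Fin ρ → ℕ) → ℝ := fun n => ∏ j, Real.exp (-(n j : ℝ) * β j * ω j)
  have hPpos : ∀ n, 0 < P n := fun n => Finset.prod_pos fun j _ => Real.exp_pos _
  have hPsum : Summable P :=
    summable_prod_pi_of_nonneg (f := fun j (k : ℕ) => Real.exp (-(k : ℝ) * β j * ω j))
      (fun _ _ => (Real.exp_pos _).le) fun j => summable_exp_neg_nat_mul (hβ j) (hω j)
  refine ⟨ρ * ∑' n, P n, mul_pos (by exact_mod_cast hρ)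
    (hPsum.tsum_pos (fun n => (hPpos n).le) 0 (hPpos 0)), fun B hB => ?_⟩
  set K : ℝ := (⨅ i, B i) ^ (-(⨅ i, ω i))
  have hK₀ : 0 ≤ K := Real.rpow_nonneg (Real.iInf_nonneg fun i => zero_le_one.trans (hB i)) _
  let N : Fin ρ → ℕ := fun i => ⌈Real.log (B i) / β i⌉₊
  have hex : ∀ n : {n : Fin ρ → ℕ //
      (∀ i, 1 ≤ n i) ∧ ∃ i, (n i : ℝ) ≥ (1 / β i) * Real.log (B i) + 1}, ∃ i, N i ≤ n.1 i := by
    rintro ⟨n, -, i, hi⟩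
    refine ⟨i, Nat.ceil_le.2 ?_⟩
    rw [div_eq_inv_mul, ← one_div]
    linarith
  choose idx hidx using hex
  have hinj : Function.Injective fun n => (idx n, Function.update n.1 (idx n)
      (n.1 (idx n) - N (idx n))) := by
    intro m n hmn
    obtain ⟨hi, hu⟩ := Prod.mk.inj hmn
    have hm := hidx m
    rw [hi] at hu hm
    refine Subtype.ext (funext fun j => ?_)
    have hj := congrFun hu j
    by_cases h : j = idx n
    · subst h
      simp only [Function.update_self] at hj
      have := hidx n
      omega
    · simpa only [Function.update_of_ne h] using hj
  have hsum : Summable fun p : Fin ρ × (Fin ρ → ℕ) => K * P p.2 :=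
    (summable_prod_of_nonneg fun p => mul_nonneg hK₀ (hPpos p.2).le).2
      ⟨fun _ => hPsum.mul_left K, Summable.of_finite⟩
  calc _ ≤ ∑' p : Fin ρ × (Fin ρ → ℕ), K * P p.2 :=
        Summable.tsum_le_tsum_of_inj _ hinj (fun p _ => mul_nonneg hK₀ (hPpos p.2).le)
          (fun n => prod_exp_le_of_shift hβ hω hB n.1 (idx n) (Nat.le_ceil _) (hidx n))
          (hPsum.comp_injective Subtype.val_injective) hsum
    _ = ρ * (∑' n, P n) * K := by
        rw [hsum.tsum_prod, tsum_fintype]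
        simp only [tsum_mul_left, Finset.sum_const, Finset.card_univ, Fintype.card_fin,
          nsmul_eq_mul]
        ring
end

section
/- Let ρ ≥ 1, let ω : Fin ρ → ℝ satisfy ω i > 0 for all i, let Δ > 0, C ≥ 0, K ≥ 0, and let f : (Fin ρ → ℕ) → ℝ be a nonnegative function. Assume that for every B : Fin ρ → ℝ with B i ≥ 1 for all i, the finite sum of f over {y : Fin ρ → ℕ | ∀ i, 1 ≤ y i ∧ (y i : ℝ) ≤ B i} satisfies |Σ f(y) − C · ∏ i, (B i)^(ω i)| ≤ K · (∏ i, (B i)^(ω i)) · (min over i of B i)^(−Δ). Then there exist constants K' > 0 and B₀ ≥ 3 such that for every real B ≥ B₀, the finite sum of f over {y : Fin ρ → ℕ | ∀ i, 1 ≤ y i, and ∏ i, ((y i : ℝ))^(ω i) ≤ B} satisfies |Σ f(y) − (C / (ρ−1)!) · B · (Real.log B)^(ρ−1)| ≤ K' · B · (Real.log B)^(ρ−2) · (Real.log (Real.log B))^ρ, where (log B)^(ρ−2) denotes the real power with exponent (ρ : ℝ) − 2. -/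
open Finset Real

/-- Inclusion–exclusion over the corners of a box, compared with the product measure `C • e^t dt`. -/
lemma abs_sum_cell_sub_le {d : ℕ} {α : Type*} (Y : Finset α) (f : α → ℝ)
    (u : α → Fin d → ℝ) (C E : ℝ) (a b : Fin d → ℝ) (hab : ∀ i, a i ≤ b i)
    (h : ∀ t : Fin d → ℝ, (∀ i, t i = a i ∨ t i = b i) →
      |∑ y ∈ Y with ∀ i, u y i ≤ t i, f y - C * exp (∑ i, t i)| ≤ E) :
    |∑ y ∈ Y with ∀ i, a i < u y i ∧ u y i ≤ b i, f y - C * ∏ i, (exp (b i) - exp (a i))|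
      ≤ 2 ^ d * E := by
  set corner : Finset (Fin d) → Fin d → ℝ := fun s i => if i ∈ s then a i else b i with hcorner
  have expand : ∀ F G : Fin d → ℝ, ∏ i, (F i - G i)
      = ∑ s : Finset (Fin d), (-1) ^ #s * ∏ i, (if i ∈ s then G i else F i) := by
    intro F G
    rw [prod_sub, powerset_univ]
    refine sum_congr rfl fun s _ => ?_
    rw [prod_ite, mul_assoc, mul_comm (∏ i ∈ univ \ s, F i)]
    congr 3 <;> · ext i; simp
  have cell : ∑ y ∈ Y with ∀ i, a i < u y i ∧ u y i ≤ b i, f y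
      = ∑ s : Finset (Fin d), (-1) ^ #s * ∑ y ∈ Y with ∀ i, u y i ≤ corner s i, f y := by
    have indicator_eq : ∀ y, (if ∀ i, a i < u y i ∧ u y i ≤ b i then f y else 0)
        = ∑ s : Finset (Fin d), (-1) ^ #s * (if ∀ i, u y i ≤ corner s i then f y else 0) := by
      intro y
      have h1 := expand (fun i => if u y i ≤ b i then 1 else 0)
        (fun i => if u y i ≤ a i then 1 else 0)
      have h2 : ∏ i, ((if u y i ≤ b i then 1 else 0) - (if u y i ≤ a i then 1 else 0) : ℝ)
          = if ∀ i, a i < u y i ∧ u y i ≤ b i then 1 else 0 := by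
        trans ∏ i, if a i < u y i ∧ u y i ≤ b i then 1 else 0
        · refine prod_congr rfl fun i _ => ?_
          have := hab i
          split_ifs <;> grind
        · rw [Fintype.prod_boole]
          congr
      have h3 : ∀ s : Finset (Fin d), (∏ i, if i ∈ s then (if u y i ≤ a i then 1 else 0)
          else (if u y i ≤ b i then 1 else 0) : ℝ) = if ∀ i, u y i ≤ corner s i then 1 else 0 := by
        intro s
        trans ∏ i, if u y i ≤ corner s i then 1 else 0
        · refine prod_congr rfl fun i _ => ?_
          simp only [hcorner]
          split_ifs <;> rfl
        · rw [Fintype.prod_boole]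
          congr
      simp only [h3] at h1
      rw [h2] at h1
      calc _ = (if ∀ i, a i < u y i ∧ u y i ≤ b i then 1 else 0) * f y := by simp
        _ = _ := by
          rw [h1, sum_mul]
          refine sum_congr rfl fun s _ => ?_
          simp
    simp only [sum_filter, mul_sum]
    rw [sum_comm]
    refine sum_congr rfl fun y _ => ?_
    rw [indicator_eq y]
  rw [cell, expand, mul_sum, ← sum_sub_distrib]
  refine (abs_sum_le_sum_abs _ _).trans ?_
  refine (sum_le_card_nsmul univ _ E fun s _ => ?_).trans_eq (by simp)
  have hexp : ∏ i, (if i ∈ s then exp (a i) else exp (b i)) = exp (∑ i, corner s i) := by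
    rw [exp_sum]
    exact prod_congr rfl fun i _ => by simp only [hcorner]; split_ifs <;> rfl
  rw [hexp, mul_left_comm, ← mul_sub, abs_mul, abs_pow, abs_neg, abs_one, one_pow, one_mul]
  exact h _ fun i => by simp only [hcorner]; split_ifs <;> simp

lemma card_piAntidiag_fin_succ (n s : ℕ) :
    #(piAntidiag (univ : Finset (Fin (n + 1))) s) = (s + n).choose n := by
  rw [← map_sym_eq_piAntidiag, card_map, sym_univ, card_univ,
    Sym.card_sym_eq_multichoose, Fintype.card_fin, Nat.multichoose_eq]
  rw [show n + 1 + s - 1 = n + s by omega, add_comm s n, ← Nat.choose_symm_add]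

/-- Sorting the points with all coordinates above `T` into the cells of a grid of mesh `h`. -/
lemma sum_grid {n : ℕ} {α : Type*} (Y : Finset α) (f : α → ℝ) (u : α → Fin (n + 1) → ℝ)
    (T h : ℝ) (hh : 0 < h) (M : ℕ) :
    ∑ y ∈ Y with (∀ i, T < u y i) ∧ ∑ i, (⌈(u y i - T) / h⌉₊ - 1) ≤ M, f y
      = ∑ s ∈ range (M + 1), ∑ m ∈ piAntidiag (univ : Finset (Fin (n + 1))) s,
          ∑ y ∈ Y with ∀ i, T + h * m i < u y i ∧ u y i ≤ T + h * (m i + 1), f y := by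
  rw [← sum_fiberwise_of_maps_to (g := fun y => ∑ i, (⌈(u y i - T) / h⌉₊ - 1))
    (t := range (M + 1)) (fun y hy => by simp at hy ⊢; omega)]
  refine sum_congr rfl fun s hs => ?_
  rw [← sum_fiberwise_of_maps_to (g := fun y i => ⌈(u y i - T) / h⌉₊ - 1)
    (t := piAntidiag univ s) (fun y hy => by simp at hy ⊢; exact hy.2)]
  refine sum_congr rfl fun m hm => ?_
  refine sum_congr ?_ fun _ _ => rfl
  have hm' : ∑ i, m i = s := by simpa using hm
  have hs' : s ≤ M := by simpa [Nat.lt_succ_iff] using hs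
  ext y
  have key : ∀ i, (T + h * m i < u y i ∧ u y i ≤ T + h * (m i + 1)) ↔
      (T < u y i ∧ ⌈(u y i - T) / h⌉₊ - 1 = m i) := by
    intro i
    have e1 : T < u y i ↔ ⌈(u y i - T) / h⌉₊ ≠ 0 := by
      rw [← Nat.pos_iff_ne_zero, Nat.ceil_pos, div_pos_iff_of_pos_right hh, sub_pos]
    have e2 : (T + h * m i < u y i ∧ u y i ≤ T + h * (m i + 1)) ↔
        ⌈(u y i - T) / h⌉₊ = m i + 1 := by
      rw [Nat.ceil_eq_iff (by omega), lt_div_iff₀ hh, div_le_iff₀ hh]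
      push_cast [Nat.add_sub_cancel]
      constructor <;> rintro ⟨h1, h2⟩ <;> constructor <;> linarith
    rw [e1, e2]
    omega
  simp only [mem_filter, key]
  constructor
  · rintro ⟨⟨⟨hy, h1, -⟩, -⟩, h3⟩
    exact ⟨hy, fun i => ⟨h1 i, congrFun h3 i⟩⟩
  · rintro ⟨hy, h1⟩
    have e : (fun i => ⌈(u y i - T) / h⌉₊ - 1) = m := funext fun i => (h1 i).2
    have es : ∑ i, (⌈(u y i - T) / h⌉₊ - 1) = s := by rw [← hm', ← e]
    exact ⟨⟨⟨hy, fun i => (h1 i).1, es.trans_le hs'⟩, es⟩, e⟩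

/-- The mass which the product measure `e^t dt` gives to the first `M + 1` diagonal layers of cells
of mesh `h`. -/
noncomputable def layerMass (n : ℕ) (h : ℝ) (M : ℕ) : ℝ :=
  (exp h - 1) ^ (n + 1) * ∑ s ∈ range (M + 1), ((s + n).choose n : ℝ) * exp (h * s)

lemma sum_Ico_exp_mul (h : ℝ) {a b : ℕ} (hab : a ≤ b) :
    (exp h - 1) * ∑ s ∈ Ico a b, exp (h * s) = exp (h * b) - exp (h * a) := by
  have := sum_Ico_sub (fun s : ℕ => exp (h * s)) hab
  rw [← this, mul_sum]
  refine sum_congr rfl fun s _ => ?_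
  push_cast
  rw [mul_add, exp_add, mul_one]
  ring

lemma layerMass_nonneg (n : ℕ) {h : ℝ} (hh : 0 ≤ h) (M : ℕ) : 0 ≤ layerMass n h M := by
  have : 0 ≤ exp h - 1 := by linarith [add_one_le_exp h]
  unfold layerMass
  positivity

lemma layerMass_mono (n : ℕ) {h : ℝ} (hh : 0 ≤ h) {M N : ℕ} (hMN : M ≤ N) :
    layerMass n h M ≤ layerMass n h N := by
  have : 0 ≤ exp h - 1 := by linarith [add_one_le_exp h]
  unfold layerMass
  gcongr

lemma layerMass_le (n : ℕ) {h : ℝ} (hh : 0 ≤ h) (M : ℕ) :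
    layerMass n h M ≤ exp ((n + 1) * h) * (h * (M + n)) ^ n / n.factorial * exp (h * M) := by
  have h0 : 0 ≤ exp h - 1 := by linarith [add_one_le_exp h]
  have h1 : exp h - 1 ≤ h * exp h := by
    have := add_one_le_exp (-h)
    have e : exp (-h) * exp h = 1 := by rw [← exp_add]; simp
    nlinarith [exp_pos h]
  have hsum : ∑ s ∈ range (M + 1), ((s + n).choose n : ℝ) * exp (h * s)
      ≤ ((M + n).choose n : ℝ) * ∑ s ∈ range (M + 1), exp (h * s) := by
    rw [mul_sum]
    refine sum_le_sum fun s hs => ?_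
    have : s ≤ M := by simpa [Nat.lt_succ_iff] using hs
    gcongr
  have hgeo : (exp h - 1) * ∑ s ∈ range (M + 1), exp (h * s) ≤ exp (h * (M + 1)) := by
    rw [range_eq_Ico, sum_Ico_exp_mul h (Nat.zero_le (M + 1))]
    push_cast
    linarith [exp_pos (h * 0)]
  have hch : ((M + n).choose n : ℝ) ≤ (M + n : ℝ) ^ n / n.factorial := by
    exact_mod_cast Nat.choose_le_pow_div (α := ℝ) n (M + n)
  calc layerMass n h M
      ≤ (exp h - 1) ^ (n + 1) * (((M + n).choose n : ℝ) * ∑ s ∈ range (M + 1), exp (h * s)) := by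
        unfold layerMass; gcongr
    _ = (exp h - 1) ^ n * ((M + n).choose n : ℝ)
        * ((exp h - 1) * ∑ s ∈ range (M + 1), exp (h * s)) := by ring
    _ ≤ (h * exp h) ^ n * ((M + n : ℝ) ^ n / n.factorial) * exp (h * (M + 1)) := by
        gcongr
    _ = _ := by
        rw [mul_add, exp_add, mul_pow, mul_pow, add_mul, exp_add, exp_nat_mul, mul_one, one_mul]
        ring

lemma le_layerMass (n : ℕ) {h : ℝ} (hh : 0 ≤ h) {M N : ℕ} (hNM : N ≤ M + 1) :
    (h * N) ^ n / n.factorial * (exp (h * (M + 1)) - exp (h * N)) ≤ layerMass n h M := by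
  have h0 : h ≤ exp h - 1 := by linarith [add_one_le_exp h]
  have hch : (N : ℝ) ^ n / n.factorial ≤ ((N + n).choose n : ℝ) := by
    refine le_trans ?_ (Nat.pow_le_choose (α := ℝ) n (N + n))
    have : N ≤ N + n + 1 - n := by omega
    gcongr
  have hgeo := sum_Ico_exp_mul h hNM
  have hsum : ((N + n).choose n : ℝ) * ∑ s ∈ Ico N (M + 1), exp (h * s)
      ≤ ∑ s ∈ range (M + 1), ((s + n).choose n : ℝ) * exp (h * s) := by
    rw [mul_sum]
    refine le_trans (sum_le_sum fun s hs => ?_) (sum_le_sum_of_subset_of_nonneg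
      (s := Ico N (M + 1)) (t := range (M + 1)) (fun s hs => by simp at hs ⊢; omega)
      fun _ _ _ => by positivity)
    have : N ≤ s := (mem_Ico.1 hs).1
    gcongr
  have hdiff : 0 ≤ exp (h * (M + 1)) - exp (h * N) := by
    rw [sub_nonneg]
    gcongr
    exact_mod_cast hNM
  calc _ = h ^ n * (N ^ n / n.factorial) * (exp (h * (M + 1)) - exp (h * N)) := by ring
    _ ≤ (exp h - 1) ^ n * ((N + n).choose n : ℝ) * (exp (h * (M + 1)) - exp (h * N)) := by
        have : 0 ≤ exp h - 1 := hh.trans h0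
        gcongr
    _ = (exp h - 1) ^ (n + 1) * (((N + n).choose n : ℝ) * ∑ s ∈ Ico N (M + 1), exp (h * s)) := by
        push_cast at hgeo
        rw [← hgeo]
        ring
    _ ≤ _ := by
        have : 0 ≤ exp h - 1 := hh.trans h0
        unfold layerMass
        gcongr

/-- The main term for the points with all coordinates above `T`, from above. -/
lemma exp_mul_layerMass_le (n : ℕ) {L T h : ℝ} (hh : 0 < h) (hnh : (n + 1) * h ≤ 1)
    (hT : 1 ≤ T) {M : ℕ} (hM : h * M ≤ L - (n + 1) * T) :
    exp ((n + 1) * T) * layerMass n h M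
      ≤ exp L * L ^ n / n.factorial * (1 + 3 * (n + 1) * h) := by
  have hexp : exp ((n + 1) * h) ≤ 1 + 3 * (n + 1) * h := by
    have h1 := add_one_le_exp (-((n + 1) * h))
    have e : exp (-((n + 1) * h)) * exp ((n + 1) * h) = 1 := by rw [← exp_add]; simp
    have h2 : exp ((n + 1) * h) ≤ 3 := (exp_le_exp.2 hnh).trans (by linarith [exp_one_lt_d9])
    have h3 : 0 ≤ (n + 1) * h := by positivity
    nlinarith [exp_pos ((n + 1) * h)]
  have hbase : h * (M + n) ≤ L := by nlinarith
  have hL0 : 0 ≤ L := le_trans (by positivity) hbase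
  have hL : exp ((n + 1) * T) * exp (h * M) ≤ exp L := by
    rw [← exp_add]
    gcongr
    linarith
  calc exp ((n + 1) * T) * layerMass n h M
      ≤ exp ((n + 1) * T) * (exp ((n + 1) * h) * (h * (M + n)) ^ n / n.factorial * exp (h * M)) := by
        gcongr
        exact layerMass_le n hh.le M
    _ = exp ((n + 1) * h) * (h * (M + n)) ^ n / n.factorial
        * (exp ((n + 1) * T) * exp (h * M)) := by ring
    _ ≤ (1 + 3 * (n + 1) * h) * L ^ n / n.factorial * exp L := by gcongr
    _ = _ := by ring

/-- The main term for the points with all coordinates above `T`, from below. -/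
lemma le_exp_mul_layerMass (n : ℕ) {L T l h c : ℝ} (hT : 0 ≤ T) (hh : 0 < h) (hl1 : 1 ≤ l)
    (hL0 : 0 ≤ L) (hL : L * h = 1) (hl : exp (-l) = h) (hc : (n + 1) * T + l + h ≤ c * l)
    (hcL : c * l ≤ L) (hnh : (n + 2) * h ≤ 1) {M : ℕ}
    (hM : L - (n + 1) * T - (n + 1) * h ≤ h * (M + 1))
    (hM' : L - (n + 1) * T - l ≤ h * (M + 1)) :
    exp L * L ^ n / n.factorial * (1 - (n * c + n + 2) * (l * h))
      ≤ exp ((n + 1) * T) * layerMass n h M := by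
  set x := L - (n + 1) * T with hx
  have hxl : 0 ≤ (x - l) / h := by
    apply div_nonneg _ hh.le
    linarith
  set N := ⌊(x - l) / h⌋₊ with hN
  have hN1 : h * N ≤ x - l := by
    have := Nat.floor_le hxl
    rw [le_div_iff₀ hh] at this
    linarith
  have hN2 : x - l - h ≤ h * N := by
    have := Nat.lt_floor_add_one ((x - l) / h)
    rw [div_lt_iff₀ hh] at this
    linarith
  have hNM : N ≤ M + 1 := by
    have : h * (N : ℝ) ≤ h * (M + 1) := hN1.trans hM'
    have := le_of_mul_le_mul_left this hh
    exact_mod_cast this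
  have hcl : 0 ≤ c * l := le_trans (by positivity) hc
  have hLc : L * (1 - c * l * h) = L - c * l := by linear_combination (-c * l) * hL
  have hz : c * l * h ≤ 1 := by nlinarith
  have hpow : L ^ n * (1 - n * (c * l * h)) ≤ (h * N) ^ n := by
    calc L ^ n * (1 - n * (c * l * h)) ≤ L ^ n * (1 - c * l * h) ^ n := by
          gcongr
          have := one_add_mul_le_pow (a := -(c * l * h)) (by linarith) n
          calc _ = 1 + n * -(c * l * h) := by ring
            _ ≤ _ := this
            _ = _ := by ring
      _ = (L - c * l) ^ n := by rw [← mul_pow, hLc]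
      _ ≤ (h * N) ^ n := pow_le_pow_left₀ (by linarith) (by linarith) n
  have hexp : exp x * (1 - (n + 2) * h) ≤ exp (h * (M + 1)) - exp (h * N) := by
    have h1 : exp x * (1 - (n + 1) * h) ≤ exp (h * (M + 1)) := by
      calc exp x * (1 - (n + 1) * h) ≤ exp x * exp (-((n + 1) * h)) := by
            gcongr
            linarith [add_one_le_exp (-((n + 1) * h))]
        _ = exp (x - (n + 1) * h) := by rw [← exp_add, sub_eq_add_neg]
        _ ≤ _ := exp_le_exp.2 hM
    have h2 : exp (h * N) ≤ exp x * h := by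
      calc exp (h * N) ≤ exp (x - l) := exp_le_exp.2 hN1
        _ = exp x * h := by rw [sub_eq_add_neg, exp_add, hl]
    linarith
  have hnl : (n + 2) * h ≤ (n + 2) * (l * h) := by
    gcongr
    exact le_mul_of_one_le_left hh.le hl1
  calc exp L * L ^ n / n.factorial * (1 - (n * c + n + 2) * (l * h))
      ≤ exp L * L ^ n / n.factorial * ((1 - n * (c * l * h)) * (1 - (n + 2) * h)) := by
        gcongr
        have : 0 ≤ n * (c * l * h) * ((n + 2) * h) := by positivity
        linarith
    _ = exp ((n + 1) * T) * ((L ^ n * (1 - n * (c * l * h))) / n.factorial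
        * (exp x * (1 - (n + 2) * h))) := by
        have : exp L = exp ((n + 1) * T) * exp x := by rw [← exp_add, hx]; ring_nf
        rw [this]
        ring
    _ ≤ exp ((n + 1) * T) * ((h * N) ^ n / n.factorial * (exp x * (1 - (n + 2) * h))) := by
        have : 0 ≤ 1 - (n + 2) * h := by linarith
        gcongr
    _ ≤ exp ((n + 1) * T) * ((h * N) ^ n / n.factorial
        * (exp (h * (M + 1)) - exp (h * N))) := by gcongr
    _ ≤ _ := by
        gcongr
        exact le_layerMass n hh.le hNM

/-- The points below the hyperplane `∑ i, u i = L`, compared with a grid of mesh `h`, from above. -/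
lemma sum_simplex_le {n : ℕ} {α : Type*} {Y : Finset α} {f : α → ℝ} {u : α → Fin (n + 1) → ℝ}
    (hf : ∀ y, 0 ≤ f y) {T h : ℝ} (hh : 0 < h) (L : ℝ) :
    ∑ y ∈ Y with ∑ i, u y i ≤ L, f y
      ≤ ∑ y ∈ Y with (∀ i, T < u y i) ∧
          ∑ i, (⌈(u y i - T) / h⌉₊ - 1) ≤ ⌊(L - (n + 1) * T) / h⌋₊, f y
        + ∑ i, ∑ y ∈ Y with u y i ≤ T ∧ ∑ k, u y k ≤ L, f y := by
  simp only [sum_filter]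
  rw [sum_comm (s := univ), ← sum_add_distrib]
  refine sum_le_sum fun y _ => ?_
  by_cases hL : ∑ i, u y i ≤ L
  swap
  · rw [if_neg hL]
    refine add_nonneg ?_ (sum_nonneg fun i _ => ?_) <;> split_ifs <;> simp [hf]
  rw [if_pos hL]
  by_cases hT : ∀ i, T < u y i
  · have hcells : ∑ i, (⌈(u y i - T) / h⌉₊ - 1) ≤ ⌊(L - (n + 1) * T) / h⌋₊ := by
      apply Nat.le_floor
      rw [le_div_iff₀ hh]
      push_cast
      rw [sum_mul]
      calc ∑ i, ((⌈(u y i - T) / h⌉₊ - 1 : ℕ) : ℝ) * h ≤ ∑ i, (u y i - T) := by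
            refine sum_le_sum fun i _ => ?_
            have hpos : 0 < (u y i - T) / h := div_pos (sub_pos.2 (hT i)) hh
            rw [← le_div_iff₀ hh, Nat.cast_sub (Nat.ceil_pos.2 hpos)]
            push_cast
            linarith [Nat.ceil_lt_add_one hpos.le]
        _ = ∑ i, u y i - (n + 1) * T := by simp [sum_sub_distrib]
        _ ≤ _ := by linarith
    rw [if_pos ⟨hT, hcells⟩]
    refine le_add_of_nonneg_right (sum_nonneg fun i _ => ?_)
    split_ifs <;> simp [hf]
  · push Not at hT
    obtain ⟨i, hi⟩ := hT
    have hsingle := single_le_sum (f := fun i => if u y i ≤ T ∧ ∑ k, u y k ≤ L then f y else 0)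
      (fun i _ => by split_ifs <;> simp [hf]) (mem_univ i)
    rw [if_pos ⟨hi, hL⟩] at hsingle
    refine hsingle.trans (le_add_of_nonneg_left ?_)
    split_ifs <;> simp [hf]

/-- The points below the hyperplane `∑ i, u i = L`, compared with a grid of mesh `h`, from below. -/
lemma le_sum_simplex {n : ℕ} {α : Type*} {Y : Finset α} {f : α → ℝ} {u : α → Fin (n + 1) → ℝ}
    (hf : ∀ y, 0 ≤ f y) {T h L : ℝ} (hh : 0 < h) {M : ℕ}
    (hM : (n + 1) * T + h * (M + (n + 1)) ≤ L) :
    ∑ y ∈ Y with (∀ i, T < u y i) ∧ ∑ i, (⌈(u y i - T) / h⌉₊ - 1) ≤ M, f y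
      ≤ ∑ y ∈ Y with ∑ i, u y i ≤ L, f y := by
  refine sum_le_sum_of_subset_of_nonneg (fun y hy => ?_) fun y _ _ => hf y
  simp only [mem_filter] at hy ⊢
  obtain ⟨hyY, -, hyM⟩ := hy
  refine ⟨hyY, le_trans ?_ hM⟩
  have hyM' : ∑ i, ((⌈(u y i - T) / h⌉₊ - 1 : ℕ) : ℝ) ≤ M := by exact_mod_cast hyM
  calc ∑ i, u y i ≤ ∑ i, (T + h * (((⌈(u y i - T) / h⌉₊ - 1 : ℕ) : ℝ) + 1)) := by
        refine sum_le_sum fun i _ => ?_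
        have h1 : (u y i - T) / h ≤ ((⌈(u y i - T) / h⌉₊ - 1 : ℕ) : ℝ) + 1 := by
          refine (Nat.le_ceil _).trans ?_
          exact_mod_cast (by omega)
        rw [div_le_iff₀ hh] at h1
        linarith
    _ = (n + 1) * T + h * (∑ i, ((⌈(u y i - T) / h⌉₊ - 1 : ℕ) : ℝ) + (n + 1)) := by
        rw [sum_add_distrib, ← mul_sum, sum_add_distrib]
        simp
    _ ≤ _ := by gcongr

/-- The sum of `f` over the points below `t` is `C * exp (∑ i, t i)`, with a relative error which
decays exponentially in `min t`, as long as `t` stays in `[0, R]`. -/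
def BoxAsymptotic {n : ℕ} {α : Type*} (Y : Finset α) (f : α → ℝ) (u : α → Fin (n + 1) → ℝ)
    (C K δ R : ℝ) : Prop :=
  ∀ (t : Fin (n + 1) → ℝ) (m : ℝ), 0 ≤ m → (∀ i, m ≤ t i) → (∀ i, t i ≤ R) →
    |∑ y ∈ Y with ∀ i, u y i ≤ t i, f y - C * exp (∑ i, t i)|
      ≤ K * exp (∑ i, t i) * exp (-(δ * m))

namespace BoxAsymptotic

variable {n : ℕ} {α : Type*} {Y : Finset α} {f : α → ℝ} {u : α → Fin (n + 1) → ℝ}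
  {C K δ R : ℝ}

lemma sum_le (H : BoxAsymptotic Y f u C K δ R) {t : Fin (n + 1) → ℝ} (ht : ∀ i, 0 ≤ t i)
    (htR : ∀ i, t i ≤ R) :
    ∑ y ∈ Y with ∀ i, u y i ≤ t i, f y ≤ (C + K) * exp (∑ i, t i) := by
  have h1 := (abs_le.1 (H t 0 le_rfl ht htR)).2
  simp only [mul_zero, neg_zero, exp_zero, mul_one] at h1
  linarith

lemma abs_cell_sub_le (H : BoxAsymptotic Y f u C K δ R) (hK : 0 ≤ K) {T h : ℝ} (hT : 0 ≤ T)
    (hh : 0 < h) (hh1 : h ≤ 1) (hTh : exp (-(δ * T)) ≤ h ^ (n + 2)) (m : Fin (n + 1) → ℕ)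
    (hm : ∀ i, T + h * (m i + 1) ≤ R) :
    |∑ y ∈ Y with ∀ i, T + h * m i < u y i ∧ u y i ≤ T + h * (m i + 1), f y
        - C * (exp ((n + 1) * T) * ((exp h - 1) ^ (n + 1) * exp (h * ∑ i, (m i : ℝ))))|
      ≤ K * (2 * exp 1) ^ (n + 1) * h
        * (exp ((n + 1) * T) * ((exp h - 1) ^ (n + 1) * exp (h * ∑ i, (m i : ℝ)))) := by
  have h0 : h ≤ exp h - 1 := by linarith [add_one_le_exp h]
  have hprod : ∏ i, (exp (T + h * (m i + 1)) - exp (T + h * m i))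
      = exp ((n + 1) * T) * ((exp h - 1) ^ (n + 1) * exp (h * ∑ i, (m i : ℝ))) := by
    have : ∀ i, exp (T + h * (m i + 1)) - exp (T + h * m i)
        = exp T * ((exp h - 1) * exp (h * m i)) := by
      intro i
      rw [exp_add, exp_add, mul_add, exp_add, mul_one]
      ring
    simp only [this, prod_mul_distrib, prod_const, card_univ, Fintype.card_fin]
    rw [← exp_sum, ← mul_sum, ← exp_nat_mul]
    push_cast
    ring
  have hcorner : ∀ t : Fin (n + 1) → ℝ, (∀ i, t i = T + h * m i ∨ t i = T + h * (m i + 1)) →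
      |∑ y ∈ Y with ∀ i, u y i ≤ t i, f y - C * exp (∑ i, t i)|
        ≤ K * exp ((n + 1) * T + h * ∑ i, (m i : ℝ) + (n + 1)) * h ^ (n + 2) := by
    intro t ht
    have hmh : ∀ i, 0 ≤ h * m i := fun i => by positivity
    have hup : ∀ i, t i ≤ T + h * (m i + 1) := fun i => by
      rcases ht i with h' | h' <;> rw [h']
      linarith
    refine (H t T hT (fun i => ?_) fun i => (hup i).trans (hm i)).trans ?_
    · rcases ht i with h' | h' <;> rw [h'] <;> linarith [hmh i]
    · gcongr
      calc ∑ i, t i ≤ ∑ i, (T + h * m i + 1) := sum_le_sum fun i _ => by linarith [hup i]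
        _ = _ := by
          rw [sum_add_distrib, sum_add_distrib, ← mul_sum]
          simp
  have key := abs_sum_cell_sub_le Y f u C _ (fun i => T + h * m i)
    (fun i => T + h * (m i + 1)) (fun i => by linarith) hcorner
  rw [hprod] at key
  refine key.trans ?_
  calc _ = K * (2 * exp 1) ^ (n + 1) * h
        * (exp ((n + 1) * T) * (h ^ (n + 1) * exp (h * ∑ i, (m i : ℝ)))) := by
        rw [exp_add, exp_add, mul_pow, ← exp_nat_mul]
        push_cast
        rw [mul_one]
        ring
    _ ≤ _ := by gcongr

lemma abs_sum_grid_sub_le (H : BoxAsymptotic Y f u C K δ R) (hK : 0 ≤ K) {T h : ℝ} (hT : 0 ≤ T)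
    (hh : 0 < h) (hh1 : h ≤ 1) (hTh : exp (-(δ * T)) ≤ h ^ (n + 2)) (M : ℕ)
    (hM : T + h * (M + 1) ≤ R) :
    |∑ y ∈ Y with (∀ i, T < u y i) ∧ ∑ i, (⌈(u y i - T) / h⌉₊ - 1) ≤ M, f y
        - C * (exp ((n + 1) * T) * layerMass n h M)|
      ≤ K * (2 * exp 1) ^ (n + 1) * h * (exp ((n + 1) * T) * layerMass n h M) := by
  have hmass : exp ((n + 1) * T) * layerMass n h M
      = ∑ s ∈ range (M + 1), ∑ m ∈ piAntidiag (univ : Finset (Fin (n + 1))) s,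
          exp ((n + 1) * T) * ((exp h - 1) ^ (n + 1) * exp (h * ∑ i, (m i : ℝ))) := by
    rw [layerMass, mul_sum, mul_sum]
    refine sum_congr rfl fun s _ => ?_
    have hconst : ∀ m ∈ piAntidiag (univ : Finset (Fin (n + 1))) s,
        exp ((n + 1) * T) * ((exp h - 1) ^ (n + 1) * exp (h * ∑ i, (m i : ℝ)))
          = exp ((n + 1) * T) * ((exp h - 1) ^ (n + 1) * exp (h * s)) := by
      intro m hm
      have : ∑ i, m i = s := by simpa using hm
      rw [← this]
      push_cast
      rfl
    rw [sum_congr rfl hconst, sum_const, card_piAntidiag_fin_succ, nsmul_eq_mul]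
    ring
  rw [sum_grid Y f u T h hh M, hmass]
  simp only [mul_sum, ← sum_sub_distrib]
  refine (abs_sum_le_sum_abs _ _).trans (sum_le_sum fun s hs => ?_)
  refine (abs_sum_le_sum_abs _ _).trans (sum_le_sum fun m hm => ?_)
  have hms : ∑ i, m i = s := by simpa using hm
  have hsM : s ≤ M := by simpa [Nat.lt_succ_iff] using hs
  have := H.abs_cell_sub_le hK hT hh hh1 hTh m fun i => by
    have h1 : m i ≤ M := (single_le_sum (fun _ _ => Nat.zero_le _) (mem_univ i)).trans
      (hms.trans_le hsM)
    have h2 : (m i : ℝ) ≤ M := by exact_mod_cast h1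
    refine le_trans ?_ hM
    gcongr
  simpa only [mul_sum] using this

/-- The points below the hyperplane `∑ i, u i = L` having one small coordinate. -/
lemma sum_small_coord_le (H : BoxAsymptotic Y f u C K δ R) (hCK : 0 ≤ C + K)
    (hf : ∀ y, 0 ≤ f y) (hu : ∀ y ∈ Y, ∀ i, 0 ≤ u y i) {T L : ℝ}
    (hR : L + n + 1 ≤ R) {i j : Fin (n + 1)} (hij : i ≠ j) :
    ∑ y ∈ Y with u y i ≤ T ∧ ∑ k, u y k ≤ L, f y
      ≤ (⌈T⌉₊ + 1) * (⌈L⌉₊ + 1) ^ (n - 1) * ((C + K) * exp (L + n + 1)) := by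
  set N : Fin (n + 1) → ℕ := fun k => if k = j then 0 else if k = i then ⌈T⌉₊ else ⌈L⌉₊ with hN
  set g : α → Fin (n + 1) → ℕ := fun y k => if k = j then 0 else ⌈u y k⌉₊ with hg
  have hmaps : ∀ y ∈ Y.filter (fun y => u y i ≤ T ∧ ∑ k, u y k ≤ L),
      g y ∈ Fintype.piFinset fun k => range (N k + 1) := by
    intro y hy
    obtain ⟨hyY, h1, h2⟩ := mem_filter.1 hy
    rw [Fintype.mem_piFinset]
    intro k
    have hk : u y k ≤ L := (single_le_sum (fun k _ => hu y hyY k) (mem_univ k)).trans h2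
    rw [mem_range, Nat.lt_succ_iff]
    simp only [hN, hg]
    split_ifs with hj hi
    · exact le_rfl
    · subst hi; exact Nat.ceil_le_ceil h1
    · exact Nat.ceil_le_ceil hk
  rw [← sum_fiberwise_of_maps_to hmaps]
  have hcard : #(Fintype.piFinset fun k => range (N k + 1))
      = (⌈T⌉₊ + 1) * (⌈L⌉₊ + 1) ^ (n - 1) := by
    rw [Fintype.card_piFinset]
    simp only [card_range]
    rw [← mul_prod_erase univ _ (mem_univ j), ← mul_prod_erase (univ.erase j) _
      (mem_erase.2 ⟨hij, mem_univ i⟩), prod_congr rfl (g := fun _ => ⌈L⌉₊ + 1)]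
    · rw [prod_const, card_erase_of_mem (mem_erase.2 ⟨hij, mem_univ i⟩),
        card_erase_of_mem (mem_univ j), card_univ, Fintype.card_fin]
      simp [hN, hij]
    · intro k hk
      simp only [mem_erase] at hk
      simp [hN, hk.1, hk.2.1]
  refine (sum_le_card_nsmul _ _ ((C + K) * exp (L + n + 1)) fun v hv => ?_).trans_eq ?_
  · rcases (filter (fun y => g y = v)
      (Y.filter (fun y => u y i ≤ T ∧ ∑ k, u y k ≤ L))).eq_empty_or_nonempty with he | hne
    · rw [he, sum_empty]
      positivity
    · set t : Fin (n + 1) → ℝ := fun k => if k = j then L + n + 1 - ∑ l, (v l : ℝ) else v k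
        with ht
      have hvj : ∀ y, g y = v → v j = 0 := by
        intro y hy
        rw [← hy]; simp [hg]
      have hbound : ∀ y ∈ Y, ∑ k, u y k ≤ L → g y = v → ∀ k, u y k ≤ t k := by
        intro y hy hyL hyv k
        simp only [ht]
        split_ifs with hk
        · have hle : ∑ l, (v l : ℝ) ≤ ∑ l, (if l = j then 0 else u y l + 1) := by
            refine sum_le_sum fun l _ => ?_
            rw [← hyv]
            simp only [hg]
            split_ifs
            · simp
            · exact (Nat.ceil_lt_add_one (hu y hy l)).le
          have heq : ∑ l, (if l = j then 0 else u y l + 1) + (u y j + 1)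
              = ∑ l, u y l + (n + 1) := by
            rw [← sum_erase_add univ _ (mem_univ j), if_pos rfl, add_zero,
              sum_congr rfl (g := fun l => u y l + 1)
                (fun l hl => if_neg (ne_of_mem_erase hl)),
              sum_erase_add univ (fun l => u y l + 1) (mem_univ j), sum_add_distrib]
            simp
          subst hk
          linarith
        · rw [← hyv]
          simp only [hg, if_neg hk]
          exact Nat.le_ceil _
      have htsum : v j = 0 → ∑ k, t k = L + n + 1 := by
        intro h0
        have hsplit := sum_erase_add univ (fun l => (v l : ℝ)) (mem_univ j)
        rw [← sum_erase_add univ _ (mem_univ j), sum_congr rfl (g := fun l => (v l : ℝ))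
          (fun l hl => if_neg (ne_of_mem_erase hl))]
        simp only [ht, if_pos, h0, Nat.cast_zero] at hsplit ⊢
        linarith
      obtain ⟨y₀, hy₀⟩ := hne
      simp only [mem_filter] at hy₀
      obtain ⟨⟨hy₀Y, -, hy₀L⟩, hy₀v⟩ := hy₀
      have hts := htsum (hvj y₀ hy₀v)
      have ht0 : ∀ k, 0 ≤ t k := fun k =>
        (hu y₀ hy₀Y k).trans (hbound y₀ hy₀Y hy₀L hy₀v k)
      have htR : ∀ k, t k ≤ R := fun k =>
        ((single_le_sum (fun k _ => ht0 k) (mem_univ k)).trans_eq hts).trans hR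
      have := H.sum_le ht0 htR
      rw [hts] at this
      refine le_trans (sum_le_sum_of_subset_of_nonneg (fun y hy => ?_) fun y _ _ => hf y) this
      simp only [mem_filter] at hy ⊢
      exact ⟨hy.1.1, hbound y hy.1.1 hy.1.2.2 hy.2⟩
  · rw [hcard, nsmul_eq_mul]
    push_cast
    ring

lemma abs_sum_simplex_sub_le {L : ℝ} (H : BoxAsymptotic Y f u C K δ (2 * L)) (hn : 1 ≤ n) (hC : 0 ≤ C)
    (hK : 0 ≤ K) (hf : ∀ y, 0 ≤ f y) (hu : ∀ y ∈ Y, ∀ i, 0 ≤ u y i) {A : ℝ} (hA : 0 ≤ A)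
    (hδA : δ * A = n + 2) (hL0 : 0 < L) (hl : n + 2 ≤ log L) (hAl : 1 ≤ A * log L)
    (hcL : ((n + 1) * A + 2) * log L ≤ L) :
    |∑ y ∈ Y with ∑ i, u y i ≤ L, f y - C * (exp L * L ^ n / n.factorial)|
      ≤ (K * (2 * exp 1) ^ (n + 1) * (3 * n + 4) + C * (3 * (n + 1))
          + C * (n * ((n + 1) * A + 2) + n + 2)
          + (n + 1) * ((A + 2) * 3 ^ (n - 1) * ((C + K) * exp (n + 1))))
        * (exp L * L ^ n * (log L / L)) := by
  set l := log L with hl_def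
  set h := L⁻¹ with hh_def
  set T := A * l with hT_def
  set c := (n + 1) * A + 2 with hc_def
  set K₁ := K * (2 * exp 1) ^ (n + 1) with hK₁
  have hn0 : (0 : ℝ) ≤ n := Nat.cast_nonneg n
  have hl0 : 0 ≤ l := by linarith
  have hc0 : 0 ≤ c := by positivity
  have hLl : l + 1 ≤ L := by
    have := add_one_le_exp l
    rwa [hl_def, exp_log hL0] at this
  have hh : 0 < h := inv_pos.2 hL0
  have hLh : L * h = 1 := mul_inv_cancel₀ hL0.ne'
  have hnh : (n + 2) * h ≤ 1 := by nlinarith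
  have hh1 : h ≤ 1 := by nlinarith
  have hexpl : exp (-l) = h := by rw [exp_neg, hl_def, exp_log hL0]
  have hTh : exp (-(δ * T)) ≤ h ^ (n + 2) := by
    rw [← hexpl, ← exp_nat_mul]
    apply le_of_eq
    congr 1
    push_cast
    rw [hT_def]
    linear_combination (-l) * hδA
  have hx : 2 * l ≤ L - (n + 1) * T := by
    rw [hT_def]
    linarith
  set x := L - (n + 1) * T with hx_def
  have hxh : 0 ≤ x / h := div_nonneg (by linarith) hh.le
  set M := ⌊x / h⌋₊ with hM_def
  have hM1 : h * M ≤ x := by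
    have := Nat.floor_le hxh
    rw [le_div_iff₀ hh] at this
    linarith
  have hM2 : x ≤ h * (M + 1) := by
    have := Nat.lt_floor_add_one (x / h)
    rw [div_lt_iff₀ hh] at this
    linarith
  have hnM : n + 1 ≤ M := by
    apply Nat.le_floor
    rw [le_div_iff₀ hh]
    push_cast
    nlinarith
  obtain ⟨N, hN⟩ := Nat.exists_eq_add_of_le' hnM
  have hNM : (M : ℝ) = N + (n + 1) := by rw [hN]; push_cast; ring
  have hTM : T + h * (M + 1) ≤ 2 * L := by nlinarith
  have hP : 0 ≤ exp L * L ^ n / n.factorial := by positivity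
  have hPD : exp L * L ^ n / n.factorial ≤ exp L * L ^ n :=
    div_le_self (by positivity) (by exact_mod_cast Nat.one_le_iff_ne_zero.2 (Nat.factorial_ne_zero n))
  set P := exp L * L ^ n / n.factorial with hP_def
  set D := exp L * L ^ n with hD_def
  have hD : 0 ≤ D := by positivity
  have hlh : h ≤ l * h := le_mul_of_one_le_left hh.le (by linarith)
  have hX1 : exp ((n + 1) * T) * layerMass n h M ≤ P * (1 + 3 * (n + 1) * h) :=
    exp_mul_layerMass_le n hh (by linarith) hAl hM1
  have hX2 : exp ((n + 1) * T) * layerMass n h N ≤ exp ((n + 1) * T) * layerMass n h M := by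
    gcongr
    exact layerMass_mono n hh.le (by omega)
  have hX3 : P * (1 - (n * c + n + 2) * (l * h)) ≤ exp ((n + 1) * T) * layerMass n h N := by
    refine le_exp_mul_layerMass n (by linarith) hh (by linarith) hL0.le hLh hexpl ?_ hcL hnh ?_ ?_
    · rw [hT_def, hc_def]; linarith
    · rw [hNM] at hM2; linarith
    · rw [hNM] at hM2; linarith
  have hX4 : exp ((n + 1) * T) * layerMass n h M ≤ P * (3 * n + 4) := by
    have : 1 + 3 * (n + 1) * h ≤ 3 * n + (4 : ℝ) := by nlinarith
    exact hX1.trans (mul_le_mul_of_nonneg_left this hP)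
  have hX0 : 0 ≤ exp ((n + 1) * T) * layerMass n h M :=
    mul_nonneg (exp_pos _).le (layerMass_nonneg n hh.le M)
  have hgridM := H.abs_sum_grid_sub_le hK (by linarith) hh hh1 hTh M hTM
  have hgridN := H.abs_sum_grid_sub_le hK (T := T) (by linarith) hh hh1 hTh N (by
    refine le_trans ?_ hTM
    gcongr
    omega)
  rw [← hK₁] at hgridM hgridN
  set X := exp ((n + 1) * T) * layerMass n h M with hX_def
  set X' := exp ((n + 1) * T) * layerMass n h N with hX'_def
  have herr : K₁ * h * X ≤ K₁ * (3 * n + 4) * (D * (l * h)) := by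
    calc K₁ * h * X ≤ K₁ * (l * h) * (D * (3 * n + 4)) := by
          gcongr
          exact hX4.trans (by gcongr)
      _ = _ := by ring
  have hsmall : ∑ i, ∑ y ∈ Y with u y i ≤ T ∧ ∑ k, u y k ≤ L, f y
      ≤ (n + 1) * ((A + 2) * 3 ^ (n - 1) * ((C + K) * exp (n + 1))) * (D * (l * h)) := by
    have hDL : D * h = exp L * L ^ (n - 1) := by
      obtain ⟨k, rfl⟩ := Nat.exists_eq_add_of_le' hn
      rw [hD_def, Nat.add_sub_cancel, pow_succ, mul_assoc, mul_assoc, hLh, mul_one]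
    have hi : ∀ i, ∑ y ∈ Y with u y i ≤ T ∧ ∑ k, u y k ≤ L, f y
        ≤ (A + 2) * 3 ^ (n - 1) * ((C + K) * exp (n + 1)) * (D * (l * h)) := by
      intro i
      obtain ⟨j, hj⟩ : ∃ j : Fin (n + 1), i ≠ j := by
        have : Nontrivial (Fin (n + 1)) := Fin.nontrivial_iff_two_le.2 (by omega)
        exact (exists_ne i).imp fun _ => Ne.symm
      have hT0 : 0 ≤ T := by linarith
      refine (H.sum_small_coord_le (by linarith) hf hu (by linarith) hj).trans ?_
      calc ((⌈T⌉₊ : ℝ) + 1) * (⌈L⌉₊ + 1) ^ (n - 1) * ((C + K) * exp (L + n + 1))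
          ≤ ((A + 2) * l) * (3 * L) ^ (n - 1) * ((C + K) * exp (L + n + 1)) := by
            gcongr
            · have := Nat.ceil_lt_add_one hT0
              linarith
            · have := Nat.ceil_lt_add_one hL0.le
              linarith
        _ = (A + 2) * 3 ^ (n - 1) * ((C + K) * exp (n + 1)) * ((exp L * L ^ (n - 1)) * l) := by
            rw [add_assoc, exp_add, mul_pow]
            ring
        _ = _ := by rw [← hDL]; ring
    refine (sum_le_sum fun i _ => hi i).trans_eq ?_
    simp
    ring
  have hup := sum_simplex_le (Y := Y) (u := u) hf (T := T) hh L
  have hlow := le_sum_simplex (Y := Y) (u := u) hf (T := T) (L := L) hh (M := N)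
    (by rw [← hNM]; linarith)
  rw [← hx_def, ← hM_def] at hup
  have hgM := (abs_le.1 hgridM).2
  have hgN := (abs_le.1 hgridN).1
  have hmainup : C * X ≤ C * P + C * (3 * (n + 1)) * (D * (l * h)) := by
    calc C * X ≤ C * (P * (1 + 3 * (n + 1) * h)) := by gcongr
      _ = C * P + C * (3 * (n + 1)) * (P * h) := by ring
      _ ≤ _ := by gcongr
  have hmainlow : C * P - C * (n * c + n + 2) * (D * (l * h)) ≤ C * X' := by
    have : C * (n * c + n + 2) * (P * (l * h)) ≤ C * (n * c + n + 2) * (D * (l * h)) := by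
      gcongr
    calc _ ≤ C * P - C * (n * c + n + 2) * (P * (l * h)) := by linarith
      _ = C * (P * (1 - (n * c + n + 2) * (l * h))) := by ring
      _ ≤ _ := by gcongr
  have herr' : K₁ * h * X' ≤ K₁ * h * X := by gcongr
  have hz : 0 ≤ D * (l * h) := by positivity
  have g1 : 0 ≤ C * (3 * (n + 1)) * (D * (l * h)) := by positivity
  have g2 : 0 ≤ C * (n * c + n + 2) * (D * (l * h)) := by positivity
  have g3 : 0 ≤ (n + 1) * ((A + 2) * 3 ^ (n - 1) * ((C + K) * exp (n + 1))) * (D * (l * h)) := by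
    positivity
  rw [div_eq_mul_inv l L, ← hh_def, abs_le]
  constructor <;> linarith

/-- In dimension one the simplex is a box. -/
lemma abs_sum_segment_sub_le {u : α → Fin 1 → ℝ} {L : ℝ} (H : BoxAsymptotic Y f u C K δ (2 * L))
    (hK : 0 ≤ K) (hδ : 0 < δ) (hL0 : 0 < L) (hl : 1 ≤ log L) :
    |∑ y ∈ Y with ∑ i, u y i ≤ L, f y - C * exp L| ≤ K / δ * (exp L * (log L / L)) := by
  have key := H (fun _ => L) L hL0.le (fun _ => le_rfl) (fun _ => by linarith)
  have hfilter : (Y.filter fun y => ∑ i, u y i ≤ L) = Y.filter fun y => ∀ i, u y i ≤ L :=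
    filter_congr fun y _ => by rw [Fin.sum_univ_one]; exact (Fin.forall_fin_one (p := fun i => u y i ≤ L)).symm
  have hsum : ∑ _i : Fin (0 + 1), L = L := by simp
  rw [hsum] at key
  rw [hfilter]
  refine key.trans ?_
  have hdecay : exp (-(δ * L)) ≤ 1 / (δ * L) := by
    rw [exp_neg, ← one_div]
    gcongr
    linarith [add_one_le_exp (δ * L)]
  calc K * exp L * exp (-(δ * L)) ≤ K * exp L * (1 / (δ * L)) := by gcongr
    _ = K / δ * (exp L * (1 / L)) := by field_simp
    _ ≤ _ := by gcongr

lemma exists_abs_sum_simplex_sub_le (n : ℕ) (α : Type*) {C K δ : ℝ} (hC : 0 ≤ C) (hK : 0 ≤ K)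
    (hδ : 0 < δ) :
    ∃ K' > 0, ∀ᶠ L in Filter.atTop, ∀ (Y : Finset α) (f : α → ℝ) (u : α → Fin (n + 1) → ℝ),
      BoxAsymptotic Y f u C K δ (2 * L) → (∀ y, 0 ≤ f y) → (∀ y ∈ Y, ∀ i, 0 ≤ u y i) →
      |∑ y ∈ Y with ∑ i, u y i ≤ L, f y - C * (exp L * L ^ n / n.factorial)|
        ≤ K' * (exp L * L ^ n * (log L / L)) := by
  rcases Nat.eq_zero_or_pos n with rfl | hn
  · refine ⟨K / δ + 1, by positivity, ?_⟩
    filter_upwards [tendsto_log_atTop.eventually_ge_atTop 1, Filter.eventually_gt_atTop 0]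
      with L hl hL0 Y f u H hf hu
    have key := H.abs_sum_segment_sub_le hK hδ hL0 hl
    simp only [pow_zero, mul_one, Nat.factorial_zero, Nat.cast_one, div_one]
    refine key.trans ?_
    gcongr
    linarith
  · set A : ℝ := (n + 2) / δ with hA_def
    have hA : 0 < A := by positivity
    set Q := K * (2 * exp 1) ^ (n + 1) * (3 * n + 4) + C * (3 * (n + 1))
          + C * (n * ((n + 1) * A + 2) + n + 2)
          + (n + 1) * ((A + 2) * 3 ^ (n - 1) * ((C + K) * exp (n + 1))) with hQ
    have hQ0 : 0 ≤ Q := by positivity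
    refine ⟨Q + 1, by positivity, ?_⟩
    have hc : 0 < ((n + 1) * A + 2)⁻¹ := by positivity
    filter_upwards [tendsto_log_atTop.eventually_ge_atTop (n + 2 : ℝ),
      tendsto_log_atTop.eventually_ge_atTop A⁻¹, Filter.eventually_gt_atTop 0,
      isLittleO_log_id_atTop.bound hc] with L hl hAl hL0 hcL Y f u H hf hu
    have hl0 : 0 ≤ log L := le_trans (by positivity) hl
    have key := H.abs_sum_simplex_sub_le hn hC hK hf hu hA.le (by rw [hA_def]; field_simp) hL0 hl
      (by rwa [inv_le_iff_one_le_mul₀' hA] at hAl)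
      (by
        rw [id, norm_of_nonneg hl0, norm_of_nonneg hL0.le, inv_mul_eq_div,
          le_div_iff₀' (by positivity)] at hcL
        exact hcL)
    exact key.trans (mul_le_mul_of_nonneg_right (by linarith) (by positivity))

end BoxAsymptotic

lemma tsum_subtype_eq_sum {α : Type*} (S : Finset α) {p : α → Prop} (hp : ∀ y, p y ↔ y ∈ S)
    (f : α → ℝ) : ∑' y : {y // p y}, f y.1 = ∑ y ∈ S, f y := by
  obtain rfl : p = (· ∈ S) := funext fun y => propext (hp y)
  exact Finset.tsum_subtype S f

/-- The integer points with `0 ≤ ω i * log (y i) ≤ R`. -/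
noncomputable def logBox {n : ℕ} (ω : Fin (n + 1) → ℝ) (R : ℝ) : Finset (Fin (n + 1) → ℕ) :=
  Fintype.piFinset fun i => Icc 1 ⌊exp (R / ω i)⌋₊

lemma cast_le_exp_div_iff {w t : ℝ} (hw : 0 < w) {k : ℕ} (hk : 1 ≤ k) :
    (k : ℝ) ≤ exp (t / w) ↔ w * log k ≤ t := by
  have : (0 : ℝ) < k := by exact_mod_cast hk
  rw [← log_le_iff_le_exp this, le_div_iff₀' hw]

lemma mem_logBox {n : ℕ} {ω : Fin (n + 1) → ℝ} (hω : ∀ i, 0 < ω i) {R : ℝ}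
    {y : Fin (n + 1) → ℕ} :
    y ∈ logBox ω R ↔ ∀ i, 1 ≤ y i ∧ ω i * log (y i) ≤ R := by
  simp only [logBox, Fintype.mem_piFinset, mem_Icc, Nat.le_floor_iff (exp_pos _).le]
  exact forall_congr' fun i => and_congr_right fun hi => cast_le_exp_div_iff (hω i) hi

lemma boxAsymptotic_logBox {n : ℕ} {ω : Fin (n + 1) → ℝ} (hω : ∀ i, 0 < ω i) {Δ C K : ℝ}
    (hΔ : 0 < Δ) (hK : 0 ≤ K) {f : (Fin (n + 1) → ℕ) → ℝ}
    (hyp : ∀ B : Fin (n + 1) → ℝ, (∀ i, 1 ≤ B i) →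
      |(∑' y : {y : Fin (n + 1) → ℕ // ∀ i, 1 ≤ y i ∧ (y i : ℝ) ≤ B i}, f y.1)
          - C * ∏ i, B i ^ (ω i)|
        ≤ K * (∏ i, B i ^ (ω i)) * (⨅ i, B i) ^ (-Δ)) (R : ℝ) :
    BoxAsymptotic (logBox ω R) f (fun y i => ω i * log (y i)) C K (Δ / ∑ i, ω i) R := by
  intro t m hm hmt htR
  have ht : ∀ i, 0 ≤ t i := fun i => hm.trans (hmt i)
  have hW : 0 < ∑ i, ω i := sum_pos (fun i _ => hω i) univ_nonempty
  have key := hyp (fun i => exp (t i / ω i)) fun i => one_le_exp (div_nonneg (ht i) (hω i).le)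
  have hprod : ∏ i, exp (t i / ω i) ^ ω i = exp (∑ i, t i) := by
    rw [exp_sum]
    refine prod_congr rfl fun i _ => ?_
    rw [← exp_mul, div_mul_cancel₀ _ (hω i).ne']
  rw [tsum_subtype_eq_sum ((logBox ω R).filter fun y => ∀ i, ω i * log (y i) ≤ t i)
    (fun y => ?_), hprod] at key
  swap
  · rw [mem_filter, mem_logBox hω]
    constructor
    · intro h
      have h' : ∀ i, ω i * log (y i) ≤ t i := fun i =>
        (cast_le_exp_div_iff (hω i) (h i).1).1 (h i).2
      exact ⟨fun i => ⟨(h i).1, (h' i).trans (htR i)⟩, h'⟩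
    · rintro ⟨h1, h2⟩ i
      exact ⟨(h1 i).1, (cast_le_exp_div_iff (hω i) (h1 i).1).2 (h2 i)⟩
  refine key.trans ?_
  gcongr
  have hinf : exp (m / ∑ i, ω i) ≤ ⨅ i, exp (t i / ω i) := by
    refine le_ciInf fun i => exp_le_exp.2 ?_
    have : ω i ≤ ∑ i, ω i := single_le_sum (fun i _ => (hω i).le) (mem_univ i)
    exact div_le_div₀ (ht i) (hmt i) (hω i) this
  calc (⨅ i, exp (t i / ω i)) ^ (-Δ) ≤ exp (m / ∑ i, ω i) ^ (-Δ) :=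
        rpow_le_rpow_of_nonpos (exp_pos _) hinf (by linarith)
    _ = _ := by
        rw [← exp_mul]
        congr 1
        ring

lemma tsum_simplex_eq {n : ℕ} {ω : Fin (n + 1) → ℝ} (hω : ∀ i, 0 < ω i)
    (f : (Fin (n + 1) → ℕ) → ℝ) {B : ℝ} (hB : 1 ≤ B) :
    ∑' y : {y : Fin (n + 1) → ℕ // (∀ i, 1 ≤ y i) ∧ ∏ i, (y i : ℝ) ^ (ω i) ≤ B}, f y.1
      = ∑ y ∈ logBox ω (2 * log B) with ∑ i, ω i * log (y i) ≤ log B, f y := by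
  refine tsum_subtype_eq_sum _ (fun y => ?_) f
  rw [mem_filter, mem_logBox hω]
  have hiff : (∀ i, 1 ≤ y i) →
      (∏ i, (y i : ℝ) ^ (ω i) ≤ B ↔ ∑ i, ω i * log (y i) ≤ log B) := by
    intro h
    have hpos : ∀ i, (0 : ℝ) < y i := fun i => by exact_mod_cast h i
    have hprod : ∏ i, (y i : ℝ) ^ (ω i) = exp (∑ i, ω i * log (y i)) := by
      rw [exp_sum]
      refine prod_congr rfl fun i _ => ?_
      rw [rpow_def_of_pos (hpos i), mul_comm]
    rw [hprod, le_log_iff_exp_le (by linarith)]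
  constructor
  · rintro ⟨h1, h2⟩
    have h3 := (hiff h1).1 h2
    refine ⟨fun i => ⟨h1 i, ?_⟩, h3⟩
    have : ω i * log (y i) ≤ ∑ i, ω i * log (y i) := single_le_sum
      (f := fun i => ω i * log (y i))
      (fun i _ => mul_nonneg (hω i).le (log_nonneg (by exact_mod_cast h1 i))) (mem_univ i)
    linarith [log_nonneg hB]
  · rintro ⟨h1, h2⟩
    exact ⟨fun i => (h1 i).1, (hiff fun i => (h1 i).1).2 h2⟩

theorem stmt_9 (ρ : ℕ) (hρ : 1 ≤ ρ) (ω : Fin ρ → ℝ) (hω : ∀ i, 0 < ω i)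
    (Δ : ℝ) (hΔ : 0 < Δ) (C K : ℝ) (hC : 0 ≤ C) (hK : 0 ≤ K)
    (f : (Fin ρ → ℕ) → ℝ) (hf : ∀ y, 0 ≤ f y)
    (hyp : ∀ B : Fin ρ → ℝ, (∀ i, 1 ≤ B i) →
      |(∑' y : {y : Fin ρ → ℕ // ∀ i, 1 ≤ y i ∧ (y i : ℝ) ≤ B i}, f y.1)
          - C * ∏ i, B i ^ (ω i)|
        ≤ K * (∏ i, B i ^ (ω i)) * (⨅ i, B i) ^ (-Δ)) :
    ∃ K' > (0 : ℝ), ∃ B₀ : ℝ, 3 ≤ B₀ ∧ ∀ B : ℝ, B₀ ≤ B →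
      |(∑' y : {y : Fin ρ → ℕ // (∀ i, 1 ≤ y i) ∧ ∏ i, ((y i : ℝ)) ^ (ω i) ≤ B}, f y.1)
          - (C / ((ρ - 1).factorial : ℝ)) * B * (Real.log B) ^ (ρ - 1)|
        ≤ K' * B * (Real.log B) ^ ((ρ : ℝ) - 2) * (Real.log (Real.log B)) ^ ρ := by
  obtain ⟨n, rfl⟩ := Nat.exists_eq_add_of_le' hρ
  have hδ : 0 < Δ / ∑ i, ω i := div_pos hΔ (sum_pos (fun i _ => hω i) univ_nonempty)
  obtain ⟨K', hK', hev⟩ :=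
    BoxAsymptotic.exists_abs_sum_simplex_sub_le n (Fin (n + 1) → ℕ) hC hK hδ
  have hev' := tendsto_log_atTop.eventually (hev.and
    ((tendsto_log_atTop.eventually_ge_atTop 1).and (Filter.eventually_gt_atTop 0)))
  obtain ⟨B₁, hB₁⟩ := Filter.eventually_atTop.1 hev'
  refine ⟨K', hK', max 3 B₁, le_max_left _ _, fun B hB => ?_⟩
  obtain ⟨hmain, hl, hL0⟩ := hB₁ B ((le_max_right _ _).trans hB)
  have hB3 : 3 ≤ B := (le_max_left _ _).trans hB
  have key := hmain (logBox ω (2 * log B)) f _ (boxAsymptotic_logBox hω hΔ hK hyp _) hf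
    fun y hy i => mul_nonneg (hω i).le
      (log_nonneg (by exact_mod_cast ((mem_logBox hω).1 hy i).1))
  rw [← tsum_simplex_eq hω f (by linarith), exp_log (by linarith)] at key
  have hpow : log B ^ (((n + 1 : ℕ) : ℝ) - 2) = log B ^ n / log B := by
    rw [← rpow_natCast, ← rpow_sub_one hL0.ne']
    congr 1
    push_cast
    ring
  rw [Nat.add_sub_cancel, hpow]
  calc _ = _ := by
        congr 2
        ring
    _ ≤ _ := key
    _ = K' * B * (log B ^ n / log B) * log (log B) := by ring
    _ ≤ _ := by
        gcongr
        exact le_self_pow₀ hl (by omega)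
end

section
/- Let ρ ≥ 1 and let G be a finite subset of ℝ^ρ whose ℝ-linear span is all of ℝ^ρ. Let C be the set of all nonnegative linear combinations of elements of G, and assume there exists a linear functional w on ℝ^ρ with w x > 0 for every nonzero x ∈ C. Then there exist a finite index set J and, for each j ∈ J, a linearly independent family v_j : Fin ρ → (Fin ρ → ℝ) (hence a basis of ℝ^ρ), such that C = ⋃_{j∈J} Λ_j, where Λ_j denotes the set of all nonnegative linear combinations of v_j 0, …, v_j (ρ−1), and such that for all i ≠ j in J the intersection Λ_i ∩ Λ_j is contained in the kernel of some nonzero linear functional on ℝ^ρ. -/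
/-- The set of all nonnegative linear combinations of the finite family `v`. -/
def nonnegComboFam {ρ m : ℕ} (v : Fin m → (Fin ρ → ℝ)) : Set (Fin ρ → ℝ) :=
  {x | ∃ c : Fin m → ℝ, (∀ i, 0 ≤ c i) ∧ x = ∑ i, c i • v i}

/-- The set of all nonnegative linear combinations of elements of the finite set `G`. -/
def nonnegComboSet {ρ : ℕ} (G : Finset (Fin ρ → ℝ)) : Set (Fin ρ → ℝ) :=
  {x | ∃ c : (Fin ρ → ℝ) → ℝ, (∀ g, 0 ≤ c g) ∧ x = ∑ g ∈ G, c g • g}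

section RegularTriangulation

variable {V : Type*} [AddCommGroup V] [Module ℝ V]

open Classical in
/-- The elements `g` of `G` at which the constraint `φ g ≤ h g` is an equality. -/
noncomputable def tightSet (G : Finset V) (h : V → ℝ) (φ : V →ₗ[ℝ] ℝ) : Finset V :=
  G.filter fun g => φ g = h g

theorem mem_tightSet {G : Finset V} {h : V → ℝ} {φ : V →ₗ[ℝ] ℝ} {g : V} :
    g ∈ tightSet G h φ ↔ g ∈ G ∧ φ g = h g := by
  classical
  simp [tightSet]

/-- The vertices of the polyhedron of functionals bounded above by `h` on `G`. -/
def dualVertices (G : Finset V) (h : V → ℝ) : Set (V →ₗ[ℝ] ℝ) :=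
  {φ | (∀ g ∈ G, φ g ≤ h g) ∧ Submodule.span ℝ (tightSet G h φ : Set V) = ⊤}

theorem dualVertices_finite (G : Finset V) (h : V → ℝ) : (dualVertices G h).Finite := by
  classical
  refine Set.Finite.of_finite_image (f := tightSet G h)
    (G.powerset.finite_toSet.subset ?_) ?_
  · rintro _ ⟨φ, -, rfl⟩
    simp only [Finset.coe_powerset, Set.mem_preimage, Set.mem_powerset_iff, Finset.coe_subset]
    exact fun g hg => (mem_tightSet.1 hg).1
  · intro φ hφ ψ _ hφψ
    refine LinearMap.ext_on hφ.2 fun g hg => ?_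
    have hg' : g ∈ tightSet G h ψ := hφψ ▸ hg
    rw [(mem_tightSet.1 hg).2, (mem_tightSet.1 hg').2]

/-- Moving from a feasible functional in a direction positive somewhere on `G`, one reaches a
new tight constraint while staying feasible. -/
theorem exists_feasible_add_smul {G : Finset V} {h : V → ℝ} {φ ψ : V →ₗ[ℝ] ℝ}
    (hφ : ∀ g ∈ G, φ g ≤ h g) (hψ : ∃ g ∈ G, 0 < ψ g) :
    ∃ ε : ℝ, 0 ≤ ε ∧ (∀ g ∈ G, (φ + ε • ψ) g ≤ h g) ∧
      ∃ g ∈ G, 0 < ψ g ∧ (φ + ε • ψ) g = h g := by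
  classical
  obtain ⟨g₁, hg₁, hpos₁⟩ := hψ
  obtain ⟨g₀, hg₀, hmin⟩ := Finset.exists_min_image (G.filter fun g => 0 < ψ g)
    (fun g => (h g - φ g) / ψ g) ⟨g₁, by simp [hg₁, hpos₁]⟩
  rw [Finset.mem_filter] at hg₀
  have hε : 0 ≤ (h g₀ - φ g₀) / ψ g₀ :=
    div_nonneg (sub_nonneg.2 (hφ g₀ hg₀.1)) hg₀.2.le
  refine ⟨(h g₀ - φ g₀) / ψ g₀, hε, fun g hg => ?_, g₀, hg₀.1, hg₀.2, ?_⟩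
  · simp only [LinearMap.add_apply, LinearMap.smul_apply, smul_eq_mul]
    rcases lt_or_ge 0 (ψ g) with hpos | hneg
    · have := hmin g (by simp [hg, hpos])
      rw [le_div_iff₀ hpos] at this
      linarith
    · have := mul_nonpos_of_nonneg_of_nonpos hε hneg
      linarith [hφ g hg]
  · simp only [LinearMap.add_apply, LinearMap.smul_apply, smul_eq_mul]
    rw [div_mul_cancel₀ _ hg₀.2.ne']
    ring

/-- The value at `x` of a feasible functional is dominated by the value of a vertex. -/
theorem exists_dualVertex_ge {G : Finset V} (hG : Submodule.span ℝ (G : Set V) = ⊤) {h : V → ℝ}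
    {x : V} (hx : ∀ ψ : V →ₗ[ℝ] ℝ, (∀ g ∈ G, ψ g ≤ 0) → ψ x ≤ 0)
    (φ : V →ₗ[ℝ] ℝ) (hφ : ∀ g ∈ G, φ g ≤ h g) :
    ∃ φ' ∈ dualVertices G h, φ x ≤ φ' x := by
  classical
  induction hn : (G \ tightSet G h φ).card using Nat.strong_induction_on generalizing φ with
  | _ n ih =>
    by_cases hs : Submodule.span ℝ (tightSet G h φ : Set V) = ⊤
    · exact ⟨φ, ⟨hφ, hs⟩, le_rfl⟩
    obtain ⟨ψ, hψ0, hψ⟩ := Submodule.exists_le_ker_of_lt_top _ (lt_top_iff_ne_top.2 hs)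
    have hψt : ∀ g ∈ tightSet G h φ, ψ g = 0 := fun g hg => hψ (Submodule.subset_span hg)
    obtain ⟨g₁, hg₁, hne⟩ : ∃ g ∈ G, ψ g ≠ 0 := by
      by_contra! hall
      exact hψ0 (LinearMap.ext_on hG fun g hg => by simpa using hall g hg)
    obtain ⟨ψ', hψ't, hψ'x, hψ'pos⟩ : ∃ ψ' : V →ₗ[ℝ] ℝ, (∀ g ∈ tightSet G h φ, ψ' g = 0) ∧
        0 ≤ ψ' x ∧ ∃ g ∈ G, 0 < ψ' g := by
      have key : ∀ χ : V →ₗ[ℝ] ℝ, 0 < χ x → ∃ g ∈ G, 0 < χ g := by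
        intro χ hχ
        by_contra! hall
        exact absurd (hx χ hall) (not_le.2 hχ)
      rcases lt_trichotomy (ψ x) 0 with hlt | heq | hgt
      · have hlt' : 0 < (-ψ) x := by simpa using hlt
        exact ⟨-ψ, fun g hg => by simp [hψt g hg], hlt'.le, key _ hlt'⟩
      · rcases lt_or_gt_of_ne hne with hneg | hpos
        · exact ⟨-ψ, fun g hg => by simp [hψt g hg], by simp [heq], g₁, hg₁, by simpa using hneg⟩
        · exact ⟨ψ, hψt, heq.ge, g₁, hg₁, hpos⟩
      · exact ⟨ψ, hψt, hgt.le, key _ hgt⟩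
    obtain ⟨ε, hε, hfeas, g, hg, hgpos, hgt⟩ := exists_feasible_add_smul hφ hψ'pos
    obtain ⟨φ', hφ', hle⟩ := ih _ (by
      rw [← hn]
      refine Finset.card_lt_card (Finset.ssubset_iff_of_subset ?_ |>.2 ⟨g, ?_, ?_⟩)
      · refine Finset.sdiff_subset_sdiff le_rfl fun t ht => mem_tightSet.2 ?_
        have := mem_tightSet.1 ht
        simpa [hψ't t ht] using this
      · exact Finset.mem_sdiff.2 ⟨hg, fun hgT => hgpos.ne' (hψ't g hgT)⟩
      · simp only [Finset.mem_sdiff, not_and, not_not]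
        exact fun _ => mem_tightSet.2 ⟨hg, hgt⟩) (φ + ε • ψ') hfeas rfl
    refine ⟨φ', hφ', le_trans ?_ hle⟩
    simpa using mul_nonneg hε hψ'x

/-- There is a positive height function on `G` for which tight sets are linearly independent. -/
theorem exists_generic_height (G : Finset V) :
    ∃ h : V → ℝ, (∀ g, 0 < h g) ∧
      ∀ φ : V →ₗ[ℝ] ℝ, LinearIndepOn ℝ id (tightSet G h φ : Set V) := by
  classical
  have hrel : ∀ T : Finset V, ∃ a : V → ℝ, ¬ LinearIndepOn ℝ id (T : Set V) →
      ∑ t ∈ T, a t • t = 0 ∧ ∃ t ∈ T, a t ≠ 0 := by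
    intro T
    by_cases hT : LinearIndepOn ℝ id (T : Set V)
    · exact ⟨0, fun hT' => absurd hT hT'⟩
    · rw [linearIndepOn_finset_iff] at hT
      push Not at hT
      obtain ⟨a, ha, t, ht, hat⟩ := hT
      exact ⟨a, fun _ => ⟨by simpa using ha, t, ht, hat⟩⟩
  choose a ha using hrel
  let e : V → ℕ := fun g => G.toList.idxOf g
  have he : ∀ s ∈ G, ∀ t ∈ G, e s = e t → s = t := fun s hs t _ hst =>
    (List.idxOf_inj (Finset.mem_toList.2 hs)).1 hst
  let P : Finset V → Polynomial ℝ := fun T => ∑ t ∈ T, Polynomial.monomial (e t) (a T t)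
  have hP : ∀ T ⊆ G, ¬ LinearIndepOn ℝ id (T : Set V) → P T ≠ 0 := by
    intro T hTG hT hPT
    obtain ⟨-, t, ht, hat⟩ := ha T hT
    apply hat
    have hcoeff : (P T).coeff (e t) = a T t := by
      simp only [P, Polynomial.finsetSum_coeff, Polynomial.coeff_monomial]
      rw [Finset.sum_eq_single_of_mem t ht]
      · simp
      · intro s hs hst
        rw [if_neg fun hes => hst (he s (hTG hs) t (hTG ht) hes)]
    rw [← hcoeff, hPT, Polynomial.coeff_zero]
  obtain ⟨r, hr, hroot⟩ := (Set.Ioi_infinite (0 : ℝ)).exists_notMem_finset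
    (G.powerset.biUnion fun T => (P T).roots.toFinset)
  refine ⟨fun g => r ^ e g, fun g => pow_pos hr _, fun φ => ?_⟩
  by_contra hT
  have hsub : tightSet G (fun g => r ^ e g) φ ⊆ G := fun g hg => (mem_tightSet.1 hg).1
  refine hroot (Finset.mem_biUnion.2 ⟨_, Finset.mem_powerset.2 hsub, ?_⟩)
  rw [Multiset.mem_toFinset, Polynomial.mem_roots (hP _ hsub hT), Polynomial.IsRoot.def]
  have := congrArg φ (ha _ hT).1
  rw [map_sum, map_zero] at this
  rw [← this, Polynomial.eval_finsetSum]
  refine Finset.sum_congr rfl fun t ht => ?_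
  rw [Polynomial.eval_monomial, map_smul, (mem_tightSet.1 ht).2, smul_eq_mul]

end RegularTriangulation

theorem map_nonpos_of_mem_nonnegComboSet {ρ : ℕ} {G : Finset (Fin ρ → ℝ)} {x : Fin ρ → ℝ}
    (hx : x ∈ nonnegComboSet G) (ψ : (Fin ρ → ℝ) →ₗ[ℝ] ℝ) (hψ : ∀ g ∈ G, ψ g ≤ 0) :
    ψ x ≤ 0 := by
  obtain ⟨c, hc, rfl⟩ := hx
  rw [map_sum]
  refine Finset.sum_nonpos fun g hg => ?_
  rw [map_smul, smul_eq_mul]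
  exact mul_nonpos_of_nonneg_of_nonpos (hc g) (hψ g hg)

theorem nonnegComboSet_mono {ρ : ℕ} {S T : Finset (Fin ρ → ℝ)} (hST : S ⊆ T) :
    nonnegComboSet S ⊆ nonnegComboSet T := by
  classical
  rintro _ ⟨c, hc, rfl⟩
  refine ⟨fun g => if g ∈ S then c g else 0, fun g => ?_, ?_⟩
  · dsimp only
    split_ifs
    exacts [hc g, le_rfl]
  · simp only [ite_smul, zero_smul]
    rw [Finset.sum_ite_mem, Finset.inter_eq_right.2 hST]

/-- A linearly independent spanning finite set can be enumerated by `Fin ρ`, with the same cone. -/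
theorem exists_linearIndependent_nonnegComboFam_eq {ρ : ℕ} {T : Finset (Fin ρ → ℝ)}
    (hli : LinearIndepOn ℝ id (T : Set (Fin ρ → ℝ)))
    (hspan : Submodule.span ℝ (T : Set (Fin ρ → ℝ)) = ⊤) :
    ∃ v : Fin ρ → (Fin ρ → ℝ), LinearIndependent ℝ v ∧ nonnegComboFam v = nonnegComboSet T := by
  classical
  let b : Module.Basis T ℝ (Fin ρ → ℝ) := Module.Basis.mk (v := fun t : T => (t : Fin ρ → ℝ)) hli
    (by simp [hspan])
  let e : T ≃ Fin ρ := b.indexEquiv (Pi.basisFun ℝ (Fin ρ))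
  have hli' : LinearIndependent ℝ (fun t : T => (t : Fin ρ → ℝ)) := hli
  refine ⟨fun i => (e.symm i : Fin ρ → ℝ), hli'.comp _ e.symm.injective, ?_⟩
  ext x
  constructor
  · rintro ⟨c, hc, rfl⟩
    refine ⟨fun g => if hg : g ∈ T then c (e ⟨g, hg⟩) else 0, fun g => ?_, ?_⟩
    · dsimp only
      split_ifs
      exacts [hc _, le_rfl]
    · rw [← Finset.sum_coe_sort T, ← e.sum_comp]
      simp
  · rintro ⟨c, hc, rfl⟩
    refine ⟨fun i => c (e.symm i), fun i => hc _, ?_⟩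
    rw [← Finset.sum_coe_sort T, ← e.symm.sum_comp]

/-- A point of the cone over `G` lies in the cone over the tight set of some vertex. -/
theorem exists_dualVertex_mem_nonnegComboSet {ρ : ℕ} {G : Finset (Fin ρ → ℝ)}
    (hG : Submodule.span ℝ (G : Set (Fin ρ → ℝ)) = ⊤) {h : (Fin ρ → ℝ) → ℝ}
    (hpos : ∀ g, 0 < h g)
    (hgen : ∀ φ : (Fin ρ → ℝ) →ₗ[ℝ] ℝ,
      LinearIndepOn ℝ id (tightSet G h φ : Set (Fin ρ → ℝ)))
    {x : Fin ρ → ℝ} (hx : x ∈ nonnegComboSet G) :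
    ∃ φ ∈ dualVertices G h, x ∈ nonnegComboSet (tightSet G h φ) := by
  classical
  have hx' := map_nonpos_of_mem_nonnegComboSet hx
  obtain ⟨φ₀, hφ₀, -⟩ := exists_dualVertex_ge hG hx' 0 (fun g _ => (hpos g).le)
  obtain ⟨φ, hφ, hmax⟩ := Set.exists_max_image _ (fun φ : (Fin ρ → ℝ) →ₗ[ℝ] ℝ => φ x)
    (dualVertices_finite G h) ⟨φ₀, hφ₀⟩
  refine ⟨φ, hφ, ?_⟩
  let T := tightSet G h φ
  let b : Module.Basis T ℝ (Fin ρ → ℝ) :=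
    Module.Basis.mk (v := fun t : T => (t : Fin ρ → ℝ)) (hgen φ)
      (by
        have := hφ.2
        simp [T, this])
  have hb : ∀ t : T, b t = t := fun t => Module.Basis.mk_apply _ _ t
  have hcoord : ∀ t, 0 ≤ b.repr x t := by
    by_contra! hneg
    obtain ⟨t, ht⟩ := hneg
    let ψ := -b.coord t
    have hψx : 0 < ψ x := by simpa [ψ] using ht
    have hψT : ∀ s ∈ T, ψ s ≤ 0 := by
      intro s hs
      have : b.repr s = Finsupp.single ⟨s, hs⟩ 1 := by
        rw [← b.repr_self, hb]
      simp only [ψ, LinearMap.neg_apply, Module.Basis.coord_apply, this, Left.neg_nonpos_iff,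
        Finsupp.single_apply]
      split_ifs <;> norm_num
    obtain ⟨ε, hε, hfeas, g, hg, hgpos, hgt⟩ := exists_feasible_add_smul (ψ := ψ) hφ.1 (by
      by_contra! hall
      exact absurd (hx' ψ hall) (not_le.2 hψx))
    have hε' : 0 < ε := by
      refine lt_of_le_of_ne hε fun h0 => ?_
      have : g ∈ T := mem_tightSet.2 ⟨hg, by simpa [← h0] using hgt⟩
      exact absurd (hψT g this) (not_le.2 hgpos)
    obtain ⟨φ', hφ', hle⟩ := exists_dualVertex_ge hG hx' _ hfeas
    have h1 := hmax φ' hφ'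
    have h2 := mul_pos hε' hψx
    simp only [LinearMap.add_apply, LinearMap.smul_apply, smul_eq_mul] at hle
    linarith
  refine ⟨fun g => if hg : g ∈ T then b.repr x ⟨g, hg⟩ else 0, fun g => ?_, ?_⟩
  · dsimp only
    split_ifs
    exacts [hcoord _, le_rfl]
  · change x = ∑ g ∈ T, _
    rw [← Finset.sum_coe_sort T]
    conv_lhs => rw [← b.sum_repr x]
    refine Finset.sum_congr rfl fun t _ => ?_
    simp [hb]

/-- On the cone over the tight set of `φ`, every feasible functional is at most `φ`. -/
theorem le_of_mem_nonnegComboSet_tightSet {ρ : ℕ} {G : Finset (Fin ρ → ℝ)}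
    {h : (Fin ρ → ℝ) → ℝ} {φ φ' : (Fin ρ → ℝ) →ₗ[ℝ] ℝ} (hφ' : ∀ g ∈ G, φ' g ≤ h g)
    {x : Fin ρ → ℝ} (hx : x ∈ nonnegComboSet (tightSet G h φ)) : φ' x ≤ φ x := by
  have := map_nonpos_of_mem_nonnegComboSet hx (φ' - φ) fun g hg => by
    obtain ⟨hgG, hgt⟩ := mem_tightSet.1 hg
    simpa [hgt] using hφ' g hgG
  simpa using this

theorem stmt_12 (ρ : ℕ) (hρ : 1 ≤ ρ) (G : Finset (Fin ρ → ℝ))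
    (hspan : Submodule.span ℝ (G : Set (Fin ρ → ℝ)) = ⊤)
    (w : (Fin ρ → ℝ) →ₗ[ℝ] ℝ)
    (hw : ∀ x ∈ nonnegComboSet G, x ≠ 0 → 0 < w x) :
    ∃ (m : ℕ) (v : Fin m → Fin ρ → (Fin ρ → ℝ)),
      (∀ j, LinearIndependent ℝ (v j)) ∧
      (nonnegComboSet G = ⋃ j, nonnegComboFam (v j)) ∧
      (∀ j k, j ≠ k → ∃ φ : (Fin ρ → ℝ) →ₗ[ℝ] ℝ, φ ≠ 0 ∧
        nonnegComboFam (v j) ∩ nonnegComboFam (v k) ⊆ (LinearMap.ker φ : Set (Fin ρ → ℝ))) := by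
  obtain ⟨h, hpos, hgen⟩ := exists_generic_height G
  have := (dualVertices_finite G h).to_subtype
  obtain ⟨m, ⟨e⟩⟩ := Finite.exists_equiv_fin (dualVertices G h)
  have hv : ∀ j : Fin m, ∃ v : Fin ρ → (Fin ρ → ℝ), LinearIndependent ℝ v ∧
      nonnegComboFam v = nonnegComboSet (tightSet G h (e.symm j)) := fun j =>
    exists_linearIndependent_nonnegComboFam_eq (hgen _) (e.symm j).2.2
  choose v hli hcone using hv
  refine ⟨m, v, hli, ?_, fun j k hjk => ?_⟩
  · simp only [hcone]
    refine Set.Subset.antisymm (fun x hx => ?_) (Set.iUnion_subset fun j =>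
      nonnegComboSet_mono fun g hg => (mem_tightSet.1 hg).1)
    obtain ⟨φ, hφ, hxφ⟩ := exists_dualVertex_mem_nonnegComboSet hspan hpos hgen hx
    exact Set.mem_iUnion.2 ⟨e ⟨φ, hφ⟩, by simpa using hxφ⟩
  · refine ⟨(e.symm j : (Fin ρ → ℝ) →ₗ[ℝ] ℝ) - e.symm k, fun h0 => ?_, ?_⟩
    · exact hjk (e.symm.injective (Subtype.ext (sub_eq_zero.1 h0)))
    · simp only [hcone]
      rintro x ⟨hxj, hxk⟩
      rw [SetLike.mem_coe, LinearMap.mem_ker, LinearMap.sub_apply, sub_eq_zero]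
      exact le_antisymm (le_of_mem_nonnegComboSet_tightSet (e.symm j).2.1 hxk)
        (le_of_mem_nonnegComboSet_tightSet (e.symm k).2.1 hxj)
end
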